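/- arXiv:2412.20841 — 4 statements merged into one kernel-verified Lean document; each statement's English description precedes it below -/
import Mathlib

section
/- Let (X,d) be a compact geodesic metric space with diameter D > 0, and let μ be a finite Borel measure on X with full support (every nonempty open subset of X has positive measure). Assume (i) μ satisfies ball-intersection homogeneity, and (ii) every metric sphere is μ-null: μ({y ∈ X : d(x,y) = r}) = 0 for every x ∈ X and r > 0. Then every geodesic γ : [0,l] → X with 0 < l < D is extendible: for every l' ∈ (0, min{l, D−l}/4) there exists a geodesic γ̃ : [0, l+l'] → X with γ̃(s) = γ(s) for all s ∈ [0,l]. -/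
open MeasureTheory

/-- A unit-speed geodesic of length `l`: `dist (γ s) (γ t) = |s − t|` for `s, t ∈ [0, l]`. -/
def IsGeodesicOn {X : Type*} [MetricSpace X] (γ : ℝ → X) (l : ℝ) : Prop :=
  ∀ s ∈ Set.Icc (0 : ℝ) l, ∀ t ∈ Set.Icc (0 : ℝ) l, dist (γ s) (γ t) = |s - t|

/-- A geodesic space: any two points are joined by a unit-speed geodesic. -/
def IsGeodesicSpace (X : Type*) [MetricSpace X] : Prop :=
  ∀ x y : X, ∃ γ : ℝ → X, IsGeodesicOn γ (dist x y) ∧ γ 0 = x ∧ γ (dist x y) = y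

/-- A geodesic from `x` to `y` followed by a geodesic from `y` to `z` is a geodesic, provided that
the lengths add up to the distance from `x` to `z`. -/
theorem IsGeodesicOn.concat {X : Type*} [MetricSpace X] {γ σ : ℝ → X} {l ε : ℝ}
    (hl : 0 ≤ l) (hε : 0 ≤ ε) (hγ : IsGeodesicOn γ l) (hσ : IsGeodesicOn σ ε)
    (hjoin : σ 0 = γ l) (hdist : l + ε ≤ dist (γ 0) (σ ε)) :
    IsGeodesicOn (fun s => if s ≤ l then γ s else σ (s - l)) (l + ε) := by
  have mixed : ∀ s t : ℝ, 0 ≤ s → s ≤ l → l < t → t ≤ l + ε →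
      dist (γ s) (σ (t - l)) = t - s := by
    intro s t hs0 hsl hlt ht
    have h1 : dist (γ 0) (γ s) = s := by
      rw [hγ 0 ⟨le_rfl, hl⟩ s ⟨hs0, hsl⟩, zero_sub, abs_neg, abs_of_nonneg hs0]
    have h2 : dist (γ s) (γ l) = l - s := by
      rw [hγ s ⟨hs0, hsl⟩ l ⟨hl, le_rfl⟩, abs_sub_comm, abs_of_nonneg (by linarith)]
    have h3 : dist (γ l) (σ (t - l)) = t - l := by
      rw [← hjoin, hσ 0 ⟨le_rfl, hε⟩ (t - l) ⟨by linarith, by linarith⟩, zero_sub, abs_neg,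
        abs_of_nonneg (by linarith)]
    have h4 : dist (σ (t - l)) (σ ε) = ε - (t - l) := by
      rw [hσ (t - l) ⟨by linarith, by linarith⟩ ε ⟨hε, le_rfl⟩, abs_sub_comm,
        abs_of_nonneg (by linarith)]
    have h5 := dist_triangle (γ s) (γ l) (σ (t - l))
    have h6 := dist_triangle4 (γ 0) (γ s) (σ (t - l)) (σ ε)
    linarith
  intro s hs t ht
  rcases le_or_gt s l with hsl | hsl <;> rcases le_or_gt t l with htl | htl
  · simp only [if_pos hsl, if_pos htl]
    exact hγ s ⟨hs.1, hsl⟩ t ⟨ht.1, htl⟩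
  · simp only [if_pos hsl, if_neg htl.not_ge]
    rw [mixed s t hs.1 hsl htl ht.2, abs_sub_comm, abs_of_nonneg (by linarith)]
  · simp only [if_neg hsl.not_ge, if_pos htl]
    rw [dist_comm, mixed t s ht.1 htl hsl hs.2, abs_of_nonneg (by linarith)]
  · simp only [if_neg hsl.not_ge, if_neg htl.not_ge]
    rw [hσ (s - l) ⟨by linarith, by linarith [hs.2]⟩ (t - l) ⟨by linarith, by linarith [ht.2]⟩,
      sub_sub_sub_cancel_right]

/-- In a nonempty compact metric space the diameter is realized by a pair of points. -/
theorem exists_dist_eq_diam_univ (X : Type*) [MetricSpace X] [CompactSpace X] [Nonempty X] :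
    ∃ p q : X, dist p q = Metric.diam (Set.univ : Set X) := by
  obtain ⟨⟨p, q⟩, -, hpq⟩ := isCompact_univ.exists_isMaxOn (Set.univ_nonempty (α := X × X))
    (f := fun z : X × X => dist z.1 z.2) continuous_dist.continuousOn
  refine ⟨p, q, le_antisymm
    (Metric.dist_le_diam_of_mem isCompact_univ.isBounded (Set.mem_univ p) (Set.mem_univ q)) ?_⟩
  exact Metric.diam_le_of_forall_dist_le dist_nonneg
    fun a _ b _ => hpq (Set.mem_univ (a, b))

/-- Ball-intersection homogeneity transfers the positivity of the measure of a difference of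
balls between pairs of points at the same distance. -/
theorem measure_ball_diff_ball_eq {X : Type*} [MetricSpace X] [MeasurableSpace X] [BorelSpace X]
    {μ : Measure X} [IsFiniteMeasure μ] {v : ℝ → ℝ → ℝ → ENNReal}
    (hv : ∀ x y : X, ∀ r s : ℝ, 0 < r → 0 < s →
      μ (Metric.ball x r ∩ Metric.ball y s) = v r s (dist x y))
    {x y p q : X} (hd : dist x y = dist p q) {r s : ℝ} (hr : 0 < r) (hs : 0 < s) :
    μ (Metric.ball y s \ Metric.ball x r) = μ (Metric.ball q s \ Metric.ball p r) := by
  have hball : ∀ a : X, μ (Metric.ball a s) = v s s 0 := fun a => by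
    simpa using hv a a s s hs hs
  have hdiff : ∀ a b : X,
      μ (Metric.ball b s \ Metric.ball a r) = v s s 0 - v r s (dist a b) := fun a b => by
    rw [← Set.sdiff_inter_self_eq_sdiff, measure_sdiff Set.inter_subset_right
      (measurableSet_ball.inter measurableSet_ball).nullMeasurableSet (measure_ne_top μ _),
      hball, hv a b r s hr hs]
  rw [hdiff, hdiff, hd]

/-- Local extendibility of geodesics in a compact geodesic space carrying a fully supported
finite Borel measure which is ball-intersection homogeneous and gives no mass to spheres
(Proposition 4.13). -/
theorem stmt_5 {X : Type*} [MetricSpace X] [CompactSpace X]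
    [MeasurableSpace X] [BorelSpace X]
    (hgeo : IsGeodesicSpace X)
    (D : ℝ) (hD : 0 < D) (hdiam : Metric.diam (Set.univ : Set X) = D)
    (μ : Measure X) [IsFiniteMeasure μ]
    (hsupp : ∀ U : Set X, IsOpen U → U.Nonempty → 0 < μ U)
    (hhom : ∃ v : ℝ → ℝ → ℝ → ENNReal, ∀ x y : X, ∀ r s : ℝ, 0 < r → 0 < s →
      μ (Metric.ball x r ∩ Metric.ball y s) = v r s (dist x y))
    (hsph : ∀ x : X, ∀ r : ℝ, 0 < r → μ (Metric.sphere x r) = 0)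
    (γ : ℝ → X) (l : ℝ) (hl : 0 < l) (hlD : l < D) (hγ : IsGeodesicOn γ l) :
    ∀ l' : ℝ, 0 < l' → l' < min l (D - l) / 4 →
      ∃ γ' : ℝ → X, IsGeodesicOn γ' (l + l') ∧ ∀ s ∈ Set.Icc (0 : ℝ) l, γ' s = γ s := by
  obtain ⟨v, hv⟩ := hhom
  intro ε hε hε'
  have hεD : ε < D - l := by
    linarith [min_le_right l (D - l)]
  have : Nonempty X := ⟨γ 0⟩
  have hγl : dist (γ 0) (γ l) = l := by
    rw [hγ 0 ⟨le_rfl, hl.le⟩ l ⟨hl.le, le_rfl⟩, zero_sub, abs_neg, abs_of_pos hl]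
  obtain ⟨p, q, hpq⟩ := exists_dist_eq_diam_univ X
  rw [hdiam] at hpq
  obtain ⟨c, hc, hc0, -⟩ := hgeo p q
  rw [hpq] at hc
  have hcl : dist p (c l) = l := by
    rw [← hc0, hc 0 ⟨le_rfl, hD.le⟩ l ⟨hl.le, hlD.le⟩, zero_sub, abs_neg, abs_of_pos hl]
  have near : ∀ s, ε < s → s ≤ D - l → ∃ w, dist (γ l) w < s ∧ l + ε ≤ dist (γ 0) w := by
    intro s hεs hsD
    have hpos : 0 < μ (Metric.ball (c l) s \ Metric.closedBall p (l + ε)) := by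
      refine hsupp _ (Metric.isOpen_ball.sdiff Metric.isClosed_closedBall)
        ⟨c (l + (ε + s) / 2), ?_, ?_⟩
      · rw [Metric.mem_ball, hc _ ⟨by linarith, by linarith⟩ l ⟨hl.le, hlD.le⟩,
          add_sub_cancel_left, abs_of_pos (by linarith)]
        linarith
      · rw [Metric.mem_closedBall, ← hc0, hc _ ⟨by linarith, by linarith⟩ 0 ⟨le_rfl, hD.le⟩,
          sub_zero, abs_of_pos (by linarith)]
        linarith
    have hpos' : 0 < μ (Metric.ball (γ l) s \ Metric.ball (γ 0) (l + ε)) := by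
      rw [measure_ball_diff_ball_eq hv (hγl.trans hcl.symm) (by linarith) (by linarith)]
      exact hpos.trans_le (measure_mono (Set.sdiff_subset_sdiff_right Metric.ball_subset_closedBall))
    obtain ⟨w, hw1, hw2⟩ := nonempty_of_measure_ne_zero hpos'.ne'
    rw [Metric.mem_ball'] at hw1
    rw [Metric.mem_ball', not_lt] at hw2
    exact ⟨w, hw1, hw2⟩
  have hclosed : IsClosed {w : X | l + ε ≤ dist (γ 0) w} :=
    isClosed_le continuous_const (continuous_const.dist continuous_id)
  obtain ⟨w, -, hw⟩ := near (D - l) hεD le_rfl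
  obtain ⟨z, hz, hzmin⟩ := hclosed.isCompact.exists_isMinOn ⟨w, hw⟩
    (f := fun w => dist (γ l) w) (continuous_const.dist continuous_id).continuousOn
  have hz : l + ε ≤ dist (γ 0) z := hz
  have hzle : dist (γ l) z ≤ ε := by
    refine le_of_forall_gt_imp_ge_of_dense fun s hs => ?_
    obtain ⟨w, hws, hw⟩ := near (min s (D - l)) (lt_min hs hεD) (min_le_right _ _)
    exact ((hzmin hw).trans hws.le).trans (min_le_left _ _)
  have hzeq : dist (γ l) z = ε := by
    linarith [dist_triangle (γ 0) (γ l) z]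
  obtain ⟨σ, hσ, hσ0, hσε⟩ := hgeo (γ l) z
  rw [hzeq] at hσ hσε
  exact ⟨_, hγ.concat hl.le hε.le hσ hσ0 (by rwa [hσε]), fun s hs => if_pos hs.2⟩
end

section
/- Let (X,d) be a compact, geodesic, non-branching metric space with diameter D > 0, and fix x₀ ∈ X. Assume that for every y ∈ X with y ≠ x₀ there is exactly one geodesic from x₀ to y, and that every geodesic issuing from x₀ of length l ∈ (0,D) extends to a geodesic of length D issuing from x₀. For y ≠ x₀ let γ̂_y : [0,D] → X denote the unique geodesic of length D issuing from x₀ that extends the geodesic from x₀ to y. Then the map Φ(y) = (γ̂_y(D/3), d(x₀,y)) is a bijection from {y ∈ X : 0 < d(x₀,y) < D} onto {z ∈ X : d(x₀,z) = D/3} × (0, D). -/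
/-- Non-branching: two geodesics of length `L` agreeing on an initial segment `[0, ε]`,
`0 < ε ≤ L`, agree on all of `[0, L]`. -/
def NonBranching (X : Type*) [MetricSpace X] : Prop :=
  ∀ (L ε : ℝ), 0 < ε → ε ≤ L → ∀ γ₁ γ₂ : ℝ → X, IsGeodesicOn γ₁ L → IsGeodesicOn γ₂ L →
    (∀ s ∈ Set.Icc (0 : ℝ) ε, γ₁ s = γ₂ s) → ∀ s ∈ Set.Icc (0 : ℝ) L, γ₁ s = γ₂ s

/-- The restriction of a geodesic to a shorter initial interval is a geodesic. -/
theorem IsGeodesicOn.mono {X : Type*} [MetricSpace X] {γ : ℝ → X} {l L : ℝ}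
    (h : IsGeodesicOn γ L) (hl : l ≤ L) : IsGeodesicOn γ l :=
  fun s hs t ht => h s ⟨hs.1, hs.2.trans hl⟩ t ⟨ht.1, ht.2.trans hl⟩

/-- A geodesic issuing from `x` is at distance `t` from `x` at time `t`. -/
theorem IsGeodesicOn.dist_eq {X : Type*} [MetricSpace X] {γ : ℝ → X} {L t : ℝ} {x : X}
    (h : IsGeodesicOn γ L) (h0 : γ 0 = x) (ht0 : 0 ≤ t) (htL : t ≤ L) :
    dist x (γ t) = t := by
  rw [← h0, h 0 ⟨le_rfl, ht0.trans htL⟩ t ⟨ht0, htL⟩, zero_sub, abs_neg, abs_of_nonneg ht0]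

/-- In a non-branching space where geodesics issuing from `x₀` are determined by their endpoint,
two geodesics issuing from `x₀` that agree at one positive time agree throughout. -/
theorem NonBranching.eqOn_of_eq_at {X : Type*} [MetricSpace X] (hnb : NonBranching X) {x₀ : X}
    (huniq : ∀ y : X, y ≠ x₀ → ∀ γ₁ γ₂ : ℝ → X,
      IsGeodesicOn γ₁ (dist x₀ y) → γ₁ 0 = x₀ → γ₁ (dist x₀ y) = y →
      IsGeodesicOn γ₂ (dist x₀ y) → γ₂ 0 = x₀ → γ₂ (dist x₀ y) = y →
      ∀ s ∈ Set.Icc (0 : ℝ) (dist x₀ y), γ₁ s = γ₂ s)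
    {L t : ℝ} (ht0 : 0 < t) (htL : t ≤ L) {γ₁ γ₂ : ℝ → X}
    (h₁ : IsGeodesicOn γ₁ L) (h₁0 : γ₁ 0 = x₀) (h₂ : IsGeodesicOn γ₂ L) (h₂0 : γ₂ 0 = x₀)
    (h : γ₁ t = γ₂ t) : ∀ s ∈ Set.Icc (0 : ℝ) L, γ₁ s = γ₂ s := by
  have hd : dist x₀ (γ₁ t) = t := h₁.dist_eq h₁0 ht0.le htL
  have hne : γ₁ t ≠ x₀ := (dist_pos.1 (hd.symm ▸ ht0)).symm
  have hu := huniq (γ₁ t) hne γ₁ γ₂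
  rw [hd] at hu
  exact hnb L t ht0 htL γ₁ γ₂ h₁ h₂ (hu (h₁.mono htL) h₁0 rfl (h₂.mono htL) h₂0 h.symm)

/-- Polar coordinates (Corollary 4.15): `y ↦ (γ̂_y(D/3), d(x₀,y))` is a bijection from the
punctured ball `{0 < d(x₀,·) < D}` onto `∂B_{D/3}(x₀) × (0, D)`, where `Γ y = γ̂_y` is the
unique geodesic of length `D` issuing from `x₀` that passes through `y` at time `d(x₀,y)`. -/
theorem stmt_8 {X : Type*} [MetricSpace X] [CompactSpace X]
    (hgeo : IsGeodesicSpace X) (hnb : NonBranching X)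
    (D : ℝ) (hD : 0 < D) (hdiam : Metric.diam (Set.univ : Set X) = D)
    (x₀ : X)
    (huniq : ∀ y : X, y ≠ x₀ → ∀ γ₁ γ₂ : ℝ → X,
      IsGeodesicOn γ₁ (dist x₀ y) → γ₁ 0 = x₀ → γ₁ (dist x₀ y) = y →
      IsGeodesicOn γ₂ (dist x₀ y) → γ₂ 0 = x₀ → γ₂ (dist x₀ y) = y →
      ∀ s ∈ Set.Icc (0 : ℝ) (dist x₀ y), γ₁ s = γ₂ s)
    (hext : ∀ l : ℝ, 0 < l → l < D → ∀ γ : ℝ → X, IsGeodesicOn γ l → γ 0 = x₀ →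
      ∃ γ' : ℝ → X, IsGeodesicOn γ' D ∧ ∀ s ∈ Set.Icc (0 : ℝ) l, γ' s = γ s)
    (Γ : X → ℝ → X)
    (hΓ : ∀ y : X, y ≠ x₀ →
      IsGeodesicOn (Γ y) D ∧ Γ y 0 = x₀ ∧ Γ y (dist x₀ y) = y) :
    Set.BijOn (fun y : X => (Γ y (D / 3), dist x₀ y))
      {y : X | 0 < dist x₀ y ∧ dist x₀ y < D}
      (({z : X | dist x₀ z = D / 3} : Set X) ×ˢ Set.Ioo (0 : ℝ) D) := by
  have hne : ∀ y : X, 0 < dist x₀ y → y ≠ x₀ := fun y hy => (dist_pos.1 hy).symm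
  have hD3 : 0 < D / 3 := by positivity
  have hD3' : D / 3 ≤ D := by linarith
  refine ⟨?_, ?_, ?_⟩
  · rintro y ⟨hy0, hyD⟩
    obtain ⟨hg, h0, -⟩ := hΓ y (hne y hy0)
    exact ⟨hg.dist_eq h0 hD3.le hD3', hy0, hyD⟩
  · rintro y ⟨hy0, hyD⟩ y' ⟨hy0', -⟩ heq
    obtain ⟨hz, hr⟩ := Prod.mk.inj heq
    obtain ⟨hg, h0, hy⟩ := hΓ y (hne y hy0)
    obtain ⟨hg', h0', hy'⟩ := hΓ y' (hne y' hy0')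
    rw [← hy, ← hy', ← hr]
    exact hnb.eqOn_of_eq_at huniq hD3 hD3' hg h0 hg' h0' hz _ ⟨hy0.le, hyD.le⟩
  · rintro ⟨z, r⟩ ⟨hz, hr0, hrD⟩
    change dist x₀ z = D / 3 at hz
    change 0 < r at hr0
    change r < D at hrD
    obtain ⟨hg, h0, hzΓ⟩ := hΓ z (hne z (hz.symm ▸ hD3))
    have hd : dist x₀ (Γ z r) = r := hg.dist_eq h0 hr0.le hrD.le
    have hpos : 0 < dist x₀ (Γ z r) := hd.symm ▸ hr0
    obtain ⟨hg', h0', hy'⟩ := hΓ (Γ z r) (hne _ hpos)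
    rw [hd] at hy'
    refine ⟨Γ z r, ⟨hpos, hd.symm ▸ hrD⟩, Prod.ext ?_ hd⟩
    change Γ (Γ z r) (D / 3) = z
    rw [hnb.eqOn_of_eq_at huniq hr0 hrD.le hg' h0' hg h0 hy' _ ⟨hD3.le, hD3'⟩, ← hz, hzΓ]
end

section
/- Let (X,d) be a metric space, μ a Borel measure on X, x ∈ X, p > 0 a real number, and g : X → [0,∞) a μ-measurable function such that ∫_{B_{t₀}(x)} g dμ < ∞ for some t₀ > 0 and lim_{s→0⁺} s^{−(p+1)} ∫_{B_s(x)} g dμ = 0. Then lim_{t→0⁺} (1/t) ∫_{B_t(x) \ {x}} g(y) · d(x,y)^{−p} dμ(y) = 0. -/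
open MeasureTheory

/-- A punctured ball is covered by half-open dyadic annuli. -/
lemma ball_diff_singleton_subset_iUnion_dyadic {X : Type*} [MetricSpace X] (x : X) {t : ℝ}
    (ht : 0 < t) :
    Metric.ball x t \ {x} ⊆ ⋃ k : ℕ,
      Metric.ball x (t * (1 / 2) ^ k) \ Metric.ball x (t * (1 / 2) ^ (k + 1)) := by
  classical
  rintro y ⟨hy, hyx⟩
  have hd : 0 < dist y x := dist_pos.2 hyx
  have hex : ∃ k : ℕ, t * (1 / 2) ^ (k + 1) ≤ dist y x := by
    obtain ⟨n, hn⟩ := exists_pow_lt_of_lt_one (div_pos hd ht)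
      (by norm_num : (1 / 2 : ℝ) < 1)
    refine ⟨n, ?_⟩
    rw [lt_div_iff₀ ht] at hn
    have : (0 : ℝ) < t * (1 / 2) ^ n := by positivity
    rw [pow_succ]
    linarith
  refine Set.mem_iUnion.2 ⟨Nat.find hex, ?_, ?_⟩
  · rcases hk : Nat.find hex with _ | k
    · simpa using hy
    · exact Metric.mem_ball.2 (not_le.1 (Nat.find_min hex (by omega : k < Nat.find hex)))
  · simpa only [Metric.mem_ball, not_lt] using Nat.find_spec hex

/-- If `∫_{B_s(x)} g ≤ C s ^ (p + 1)` for all `0 < s ≤ t`, then summing over dyadic annuli bounds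
the integral of `g(y) d(x, y) ^ (-p)` over the punctured ball of radius `t`. -/
lemma norm_setIntegral_mul_dist_rpow_neg_le {X : Type*} [MetricSpace X] [MeasurableSpace X]
    [BorelSpace X] {μ : Measure X} {x : X} {p : ℝ} (hp : 0 ≤ p) {g : X → ℝ} (hg0 : ∀ y, 0 ≤ g y)
    {t C : ℝ} (ht : 0 < t) (hC : 0 ≤ C) (hint : IntegrableOn g (Metric.ball x t) μ)
    (hbound : ∀ s, 0 < s → s ≤ t → ∫ y in Metric.ball x s, g y ∂μ ≤ C * s ^ (p + 1)) :
    ‖∫ y in (Metric.ball x t \ {x}), g y * dist x y ^ (-p) ∂μ‖ ≤ 2 ^ p * C * t * 2 := by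
  have hannulus (k : ℕ) :
      ∫⁻ y in Metric.ball x (t * (1 / 2) ^ k) \ Metric.ball x (t * (1 / 2) ^ (k + 1)),
        ENNReal.ofReal ‖g y * dist x y ^ (-p)‖ ∂μ ≤
      ENNReal.ofReal (2 ^ p * C * t * (1 / 2) ^ k) := by
    set r : ℝ := t * (1 / 2) ^ k with hr
    have hr0 : 0 < r := by positivity
    have hrt : r ≤ t := mul_le_of_le_one_right ht.le (pow_le_one₀ (by norm_num) (by norm_num))
    have hr2 : t * (1 / 2) ^ (k + 1) = r / 2 := by rw [hr, pow_succ]; ring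
    rw [hr2]
    calc
      _ ≤ ∫⁻ y in Metric.ball x r \ Metric.ball x (r / 2),
            ENNReal.ofReal ((r / 2) ^ (-p)) * ENNReal.ofReal (g y) ∂μ := by
        refine setLIntegral_mono' (Metric.isOpen_ball.measurableSet.diff
          Metric.isOpen_ball.measurableSet) fun y hy => ?_
        have hy2 : r / 2 ≤ dist x y := by
          simpa only [Metric.mem_ball, not_lt, dist_comm y x] using hy.2
        rw [← ENNReal.ofReal_mul (by positivity), Real.norm_of_nonneg
          (mul_nonneg (hg0 y) (by positivity)), mul_comm (g y)]
        exact ENNReal.ofReal_le_ofReal (mul_le_mul_of_nonneg_right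
          (Real.rpow_le_rpow_of_nonpos (by positivity) hy2 (by linarith)) (hg0 y))
      _ ≤ ∫⁻ y in Metric.ball x r,
            ENNReal.ofReal ((r / 2) ^ (-p)) * ENNReal.ofReal (g y) ∂μ :=
        lintegral_mono_set Set.sdiff_subset
      _ = ENNReal.ofReal ((r / 2) ^ (-p) * ∫ y in Metric.ball x r, g y ∂μ) := by
        rw [lintegral_const_mul' _ _ ENNReal.ofReal_ne_top, ENNReal.ofReal_mul (by positivity),
          ofReal_integral_eq_lintegral_ofReal (hint.mono_set (Metric.ball_subset_ball hrt))
            (ae_of_all _ hg0)]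
      _ ≤ ENNReal.ofReal ((r / 2) ^ (-p) * (C * r ^ (p + 1))) :=
        ENNReal.ofReal_le_ofReal (mul_le_mul_of_nonneg_left (hbound r hr0 hrt) (by positivity))
      _ = _ := by
        congr 1
        rw [Real.rpow_add_one hr0.ne', Real.rpow_neg (by positivity),
          Real.div_rpow hr0.le (by norm_num), mul_assoc _ t, ← hr]
        have : r ^ p ≠ 0 := by positivity
        field_simp
  refine (norm_integral_le_lintegral_norm _).trans
    (ENNReal.toReal_le_of_le_ofReal (by positivity) ?_)
  calc
    _ ≤ _ := lintegral_mono_set (ball_diff_singleton_subset_iUnion_dyadic x ht)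
    _ ≤ _ := lintegral_iUnion_le _ _
    _ ≤ ∑' k : ℕ, ENNReal.ofReal (2 ^ p * C * t * (1 / 2) ^ k) := ENNReal.tsum_le_tsum hannulus
    _ = _ := by
      rw [← ENNReal.ofReal_tsum_of_nonneg (fun k => by positivity)
        (summable_geometric_two.mul_left _), tsum_mul_left, tsum_geometric_two]

/-- Dyadic-annuli estimate (display (4.35) in Step 2 of the proof of Proposition 4.21):
if `s^{−(p+1)} ∫_{B_s(x)} g dμ → 0` as `s → 0⁺` and `g ≥ 0` is integrable near `x`, then
`(1/t) ∫_{B_t(x)∖{x}} g(y)·d(x,y)^{−p} dμ(y) → 0` as `t → 0⁺`. -/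
theorem stmt_11 {X : Type*} [MetricSpace X] [MeasurableSpace X] [BorelSpace X]
    (μ : Measure X) (x : X) (p : ℝ) (hp : 0 < p)
    (g : X → ℝ) (hg0 : ∀ y, 0 ≤ g y) (hgm : Measurable g)
    (hint : ∃ t₀ : ℝ, 0 < t₀ ∧ IntegrableOn g (Metric.ball x t₀) μ)
    (hlim : Filter.Tendsto (fun s : ℝ => s ^ (-(p + 1)) * ∫ y in Metric.ball x s, g y ∂μ)
      (nhdsWithin 0 (Set.Ioi 0)) (nhds 0)) :
    Filter.Tendsto
      (fun t : ℝ => (1 / t) * ∫ y in (Metric.ball x t \ {x}), g y * dist x y ^ (-p) ∂μ)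
      (nhdsWithin 0 (Set.Ioi 0)) (nhds 0) := by
  obtain ⟨t₀, ht₀, hint⟩ := hint
  rw [Metric.tendsto_nhdsWithin_nhds] at hlim ⊢
  intro ε hε
  obtain ⟨δ, hδ, hsmall⟩ := hlim (ε / (2 ^ p * 4)) (by positivity)
  refine ⟨min δ t₀, lt_min hδ ht₀, fun t (ht : 0 < t) htd => ?_⟩
  rw [Real.dist_0_eq_abs, abs_of_pos ht, lt_min_iff] at htd
  have key := norm_setIntegral_mul_dist_rpow_neg_le hp.le hg0 ht
    (by positivity : 0 ≤ ε / (2 ^ p * 4))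
    (hint.mono_set (Metric.ball_subset_ball htd.2.le)) fun s hs hst => by
      have h := hsmall (Set.mem_Ioi.2 hs)
        (by rw [Real.dist_0_eq_abs, abs_of_pos hs]; exact hst.trans_lt htd.1)
      rw [Real.dist_0_eq_abs] at h
      have h' := ((le_abs_self _).trans_lt h).le
      rwa [Real.rpow_neg hs.le, inv_mul_le_iff₀ (by positivity), mul_comm] at h'
  have hconst : 2 ^ p * (ε / (2 ^ p * 4)) * t * 2 = ε / 2 * t := by
    have : (2 : ℝ) ^ p ≠ 0 := by positivity
    field_simp
    norm_num
  rw [hconst] at key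
  rw [dist_zero_right, norm_mul, Real.norm_of_nonneg (by positivity : 0 ≤ 1 / t),
    one_div, inv_mul_lt_iff₀ ht]
  nlinarith [mul_pos hε ht]
end

section
/- Let n ≥ 1 and let A = (a_{ij}) be an n × n real symmetric positive semidefinite matrix with largest eigenvalue λ_max. Then (1/n)·Σ_{i=1}^n a_{ii} ≤ λ_max, and λ_max ≤ inf_{t ∈ ℝ} ( t + Σ_{i,j=1}^n |a_{ij} − t·δ_{ij}| ). -/
open Finset in
/-- Every real eigenvalue `μ` of a square matrix `A` satisfies
`μ ≤ t + ∑ i, ∑ j, |(A - t • 1) i j|` for all `t`, by Gershgorin's circle theorem. -/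
theorem Matrix.eigenvalue_le_add_sum_abs {ι : Type*} [Fintype ι] [DecidableEq ι]
    {A : Matrix ι ι ℝ} {μ : ℝ} (hμ : Module.End.HasEigenvalue (Matrix.toLin' A) μ) (t : ℝ) :
    μ ≤ t + ∑ i, ∑ j, |A i j - if i = j then t else 0| := by
  obtain ⟨k, hk⟩ := eigenvalue_mem_ball hμ
  rw [Metric.mem_closedBall, Real.dist_eq] at hk
  have hrow : ∑ j, |A k j - if k = j then t else 0| =
      |A k k - t| + ∑ j ∈ univ.erase k, ‖A k j‖ := by
    rw [← add_sum_erase univ _ (mem_univ k), if_pos rfl]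
    congr 1
    refine sum_congr rfl fun j hj => ?_
    rw [if_neg (ne_of_mem_erase hj).symm, sub_zero, Real.norm_eq_abs]
  have hle : ∑ j, |A k j - if k = j then t else 0| ≤
      ∑ i, ∑ j, |A i j - if i = j then t else 0| :=
    single_le_sum (f := fun i => ∑ j, |A i j - if i = j then t else 0|)
      (fun i _ => sum_nonneg fun j _ => abs_nonneg _) (mem_univ k)
  linarith [le_abs_self (μ - A k k), le_abs_self (A k k - t)]

/-- Every element of the family of eigenvalues of a Hermitian real matrix is an eigenvalue of the
associated linear map. -/
theorem Matrix.IsHermitian.hasEigenvalue_eigenvalues {ι : Type*} [Fintype ι] [DecidableEq ι]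
    {A : Matrix ι ι ℝ} (hA : A.IsHermitian) (i : ι) :
    Module.End.HasEigenvalue (Matrix.toLin' A) (hA.eigenvalues i) := by
  rw [Module.End.hasEigenvalue_iff_mem_spectrum, Matrix.spectrum_toLin']
  exact hA.eigenvalues_mem_spectrum_real i


/-- Inequality (5.1) of Corollary 5.2 (Appendix): for an `n × n` real symmetric positive
semidefinite matrix `A` with largest eigenvalue `λ_max`,
`(1/n)·∑ᵢ a_{ii} ≤ λ_max ≤ inf_{t ∈ ℝ} (t + ∑_{i,j} |a_{ij} − t·δ_{ij}|)`. -/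
theorem stmt_15 (n : ℕ) (hn : 1 ≤ n) (A : Matrix (Fin n) (Fin n) ℝ)
    (hA : A.PosSemidef) (lamMax : ℝ)
    (hmax : IsGreatest (Set.range hA.isHermitian.eigenvalues) lamMax) :
    (∑ i, A i i) / n ≤ lamMax ∧
    lamMax ≤ ⨅ t : ℝ, (t + ∑ i, ∑ j, |A i j - if i = j then t else 0|) := by
  constructor
  · have htrace : ∑ i, A i i = ∑ i, hA.isHermitian.eigenvalues i :=
      hA.isHermitian.trace_eq_sum_eigenvalues
    rw [div_le_iff₀ (by exact_mod_cast hn), htrace]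
    calc ∑ i, hA.isHermitian.eigenvalues i
        ≤ ∑ _i : Fin n, lamMax := Finset.sum_le_sum fun i _ => hmax.2 ⟨i, rfl⟩
      _ = lamMax * n := by simp [mul_comm]
  · obtain ⟨i, rfl⟩ := hmax.1
    exact le_ciInf (Matrix.eigenvalue_le_add_sum_abs (hA.isHermitian.hasEigenvalue_eigenvalues i))
end
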